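/- Let 𝔣 be an additive, κ-Lipschitz, concave graph parameter and let Ψ(μ) := lim_{n→∞} E[𝔣(𝔾^iid_{μ,n})]/n for each probability measure μ on ℕ with finite mean. Then for any two probability measures μ, μ' on ℕ with finite mean, |Ψ(μ) − Ψ(μ')| ≤ 2κ·W(μ, μ'), where W denotes the Wasserstein distance. -/

import Mathlib

open Finset Filter Topology MeasureTheory
open scoped Classical BigOperators ENNReal

structure Multigraph where
  (V : Type)
  [fintypeV : Fintype V]
  (edges : Multiset (Sym2 V))

attribute [instance] Multigraph.fintypeV

def Multigraph.addEdge (G : Multigraph) (i j : G.V) : Multigraph :=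
  { V := G.V, edges := s(i, j) ::ₘ G.edges }

def Multigraph.disjUnion (G₁ G₂ : Multigraph) : Multigraph :=
  { V := G₁.V ⊕ G₂.V,
    edges := G₁.edges.map (Sym2.map Sum.inl) + G₂.edges.map (Sym2.map Sum.inr) }

/-- A graph parameter is invariant under graph isomorphism. -/
def GraphParam.Invariant (f : Multigraph → ℝ) : Prop :=
  ∀ (G₁ G₂ : Multigraph) (e : G₁.V ≃ G₂.V),
    G₂.edges = G₁.edges.map (Sym2.map e) → f G₁ = f G₂

def GraphParam.Additive (f : Multigraph → ℝ) : Prop :=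
  ∀ G₁ G₂ : Multigraph, f (G₁.disjUnion G₂) = f G₁ + f G₂

def GraphParam.Lipschitz (f : Multigraph → ℝ) (κ : ℝ) : Prop :=
  ∀ (G : Multigraph) (i j : G.V), |f (G.addEdge i j) - f G| ≤ κ

def GraphParam.Concave (f : Multigraph → ℝ) : Prop :=
  ∀ (G : Multigraph) (x : G.V → ℝ), (∑ i, x i) = 0 →
    ∑ i, ∑ j, (f (G.addEdge i j) - f G) * x i * x j ≤ 0

abbrev HalfEdge (V : Type) (d : V → ℕ) : Type := Σ i : V, Fin (d i)

def IsPairMatching {α : Type} (m : Finset (Sym2 α)) : Prop :=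
  (∀ p ∈ m, ¬ p.IsDiag) ∧
    ∀ p ∈ m, ∀ q ∈ m, p ≠ q → ∀ h : α, h ∈ p → h ∉ q

def IsMaximalMatching {α : Type} (m : Finset (Sym2 α)) : Prop :=
  IsPairMatching m ∧ ∀ m' : Finset (Sym2 α), IsPairMatching m' → m ⊆ m' → m' = m

/-- The multigraph `G[m]` induced on `V` by a matching `m` of the half-edges. -/
def matchingGraph (V : Type) [Fintype V] (d : V → ℕ)
    (m : Finset (Sym2 (HalfEdge V d))) : Multigraph :=
  { V := V, edges := m.val.map (Sym2.map Sigma.fst) }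

noncomputable def maximalMatchings (V : Type) [Fintype V] [DecidableEq V] (d : V → ℕ) :
    Finset (Finset (Sym2 (HalfEdge V d))) :=
  Finset.univ.filter fun m => IsMaximalMatching m

/-- `E[f(𝔾_d)]`: expectation of `f` under the configuration model with degrees `d`. -/
noncomputable def configExpect (V : Type) [Fintype V] [DecidableEq V] (d : V → ℕ)
    (f : Multigraph → ℝ) : ℝ :=
  (∑ m ∈ maximalMatchings V d, f (matchingGraph V d m)) / ((maximalMatchings V d).card : ℝ)

/-- `E[f(𝔾^iid_{μ,n})]`. -/
noncomputable def iidExpect (μ : ℕ → ℝ) (n : ℕ) (f : Multigraph → ℝ) : ℝ :=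
  ∑' D : Fin n → ℕ, (∏ i, μ (D i)) * configExpect (Fin n) D f

noncomputable def tailSum (μ : ℕ → ℝ) (i : ℕ) : ℝ := ∑' k : ℕ, if i ≤ k then μ k else 0

/-- The Wasserstein distance `W(μ, μ') = Σ_{i≥1} |Σ_{k≥i} (μ k - μ' k)|`. -/
noncomputable def wasserstein (μ μ' : ℕ → ℝ) : ℝ :=
  ∑' i : ℕ, |tailSum μ (i + 1) - tailSum μ' (i + 1)|

/-- Empirical degree distribution of `d : Fin n → ℕ`. -/
noncomputable def empirical (n : ℕ) (d : Fin n → ℕ) : ℕ → ℝ :=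
  fun k => ((Finset.univ.filter fun i => d i = k).card : ℝ) / (n : ℝ)

/-- The degree sequences `d n` approach the degree distribution `μ` (with mean `Σ k·μ(k)`). -/
def Approaches (d : (n : ℕ) → Fin n → ℕ) (μ : ℕ → ℝ) : Prop :=
  (∀ k : ℕ, Tendsto (fun n => empirical n (d n) k) atTop (nhds (μ k))) ∧
    Tendsto (fun n => (∑ i, (d n i : ℝ)) / (n : ℝ)) atTop
      (nhds (∑' k : ℕ, (k : ℝ) * μ k))

/-! ### Maximal matchings as involutions with at most one fixed point -/

def IsInv {α : Type} (σ : Equiv.Perm α) : Prop :=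
  (∀ x, σ (σ x) = x) ∧ ∀ x y, σ x = x → σ y = y → x = y

noncomputable def edgeSet {α : Type} [Fintype α] (σ : Equiv.Perm α) : Finset (Sym2 α) :=
  Finset.univ.filter fun p => ∃ x, p = s(x, σ x) ∧ σ x ≠ x

theorem mem_edgeSet {α : Type} [Fintype α] (σ : Equiv.Perm α) (p : Sym2 α) :
    p ∈ edgeSet σ ↔ ∃ x, p = s(x, σ x) ∧ σ x ≠ x := by
  simp [edgeSet]

theorem edgeSet_eq_of_mem {α : Type} [Fintype α] {σ : Equiv.Perm α} (hσ : IsInv σ)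
    {p : Sym2 α} (hp : p ∈ edgeSet σ) {h : α} (hh : h ∈ p) : p = s(h, σ h) ∧ σ h ≠ h := by
  obtain ⟨x, rfl, hx⟩ := (mem_edgeSet σ p).1 hp
  rcases Sym2.mem_iff.1 hh with rfl | rfl
  · exact ⟨rfl, hx⟩
  · rw [hσ.1]
    exact ⟨Sym2.eq_swap, fun h => hx h.symm⟩

theorem edgeSet_inj {α : Type} [Fintype α] {σ τ : Equiv.Perm α} (hσ : IsInv σ) (hτ : IsInv τ)
    (h : edgeSet σ = edgeSet τ) : σ = τ := by
  have key : ∀ {σ τ : Equiv.Perm α}, IsInv τ → edgeSet σ = edgeSet τ → ∀ x, σ x ≠ x → σ x = τ x := by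
    intro σ τ hτ h x hx
    have h1 : s(x, σ x) ∈ edgeSet τ := by
      rw [← h]; exact (mem_edgeSet _ _).2 ⟨x, rfl, hx⟩
    have h2 := (edgeSet_eq_of_mem hτ h1 (Sym2.mem_mk_left x (σ x))).1
    exact Sym2.congr_right.1 h2
  ext x
  by_cases hx : σ x = x
  · by_cases hx' : τ x = x
    · rw [hx, hx']
    · exact (key hσ h.symm x hx').symm
  · exact key hτ h x hx

theorem edgeSet_maximal {α : Type} [Fintype α] {σ : Equiv.Perm α} (hσ : IsInv σ) :
    IsMaximalMatching (edgeSet σ) := by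
  refine ⟨⟨?_, ?_⟩, ?_⟩
  · intro p hp
    obtain ⟨x, rfl, hx⟩ := (mem_edgeSet σ p).1 hp
    simpa using fun h => hx h.symm
  · intro p hp q hq hpq h h1 h2
    exact hpq ((edgeSet_eq_of_mem hσ hp h1).1.trans (edgeSet_eq_of_mem hσ hq h2).1.symm)
  · intro m' hm' hsub
    refine Finset.Subset.antisymm ?_ hsub
    intro p hp
    induction p with
    | _ x y =>
    have hxy : x ≠ y := by simpa using hm'.1 _ hp
    have key : ∀ z ∈ s(x, y), σ z ≠ z → s(x, y) ∈ edgeSet σ := by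
      intro z hz hne
      have h1 : s(z, σ z) ∈ edgeSet σ := (mem_edgeSet _ _).2 ⟨z, rfl, hne⟩
      by_contra hcon
      exact hm'.2 _ hp _ (hsub h1) (fun h => hcon (h ▸ h1)) z hz (Sym2.mem_mk_left _ _)
    by_cases hx : σ x = x
    · exact key y (Sym2.mem_mk_right _ _) (fun hy => hxy (hσ.2 _ _ hx hy))
    · exact key x (Sym2.mem_mk_left _ _) hx

theorem edgeSet_surj {α : Type} [Fintype α] {m : Finset (Sym2 α)} (hm : IsMaximalMatching m) :
    ∃ σ : Equiv.Perm α, IsInv σ ∧ edgeSet σ = m := by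
  obtain ⟨⟨hd, hdisj⟩, hmax⟩ := hm
  have uniq : ∀ {x y z : α}, s(x, y) ∈ m → s(x, z) ∈ m → y = z := by
    intro x y z h1 h2
    by_contra hne
    exact hdisj _ h1 _ h2 (fun h => hne (Sym2.congr_right.1 h)) x (Sym2.mem_mk_left _ _)
      (Sym2.mem_mk_left _ _)
  let g : α → α := fun x => if h : ∃ y, s(x, y) ∈ m then h.choose else x
  have g1 : ∀ {x y}, s(x, y) ∈ m → g x = y := by
    intro x y h
    have hex : ∃ y, s(x, y) ∈ m := ⟨y, h⟩
    have : g x = hex.choose := dif_pos hex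
    rw [this]
    exact uniq hex.choose_spec h
  have g2 : ∀ {x}, (¬ ∃ y, s(x, y) ∈ m) → g x = x := fun h => dif_neg h
  have hinv : Function.Involutive g := by
    intro x
    by_cases h : ∃ y, s(x, y) ∈ m
    · obtain ⟨y, hy⟩ := h
      rw [g1 hy]
      exact g1 (by rwa [Sym2.eq_swap])
    · rw [g2 h, g2 h]
  have hfix : ∀ x, g x = x → ¬ ∃ y, s(x, y) ∈ m := by
    rintro x hx ⟨y, hy⟩
    have := hd _ hy
    rw [← g1 hy, hx] at this
    simp at this
  refine ⟨hinv.toPerm, ⟨hinv, ?_⟩, ?_⟩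
  · intro x y hx hy
    have hx' := hfix x hx
    have hy' := hfix y hy
    by_contra hne
    have hx2 : ∀ q ∈ m, x ∉ q := by
      intro q hq hxq
      obtain ⟨z, rfl⟩ := hxq
      exact hx' ⟨z, hq⟩
    have hy2 : ∀ q ∈ m, y ∉ q := by
      intro q hq hxq
      obtain ⟨z, rfl⟩ := hxq
      exact hy' ⟨z, hq⟩
    have := hmax (insert s(x, y) m) ⟨?_, ?_⟩ (Finset.subset_insert _ _)
    · exact hx' ⟨y, this ▸ Finset.mem_insert_self _ _⟩
    · intro p hp
      rcases Finset.mem_insert.1 hp with rfl | hp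
      · simpa using hne
      · exact hd _ hp
    · intro p hp q hq hpq h h1 h2
      rcases Finset.mem_insert.1 hp with rfl | hp' <;> rcases Finset.mem_insert.1 hq with rfl | hq'
      · exact hpq rfl
      · rcases Sym2.mem_iff.1 h1 with rfl | rfl
        · exact hx2 _ hq' h2
        · exact hy2 _ hq' h2
      · rcases Sym2.mem_iff.1 h2 with rfl | rfl
        · exact hx2 _ hp' h1
        · exact hy2 _ hp' h1
      · exact hdisj _ hp' _ hq' hpq h h1 h2
  · ext p
    rw [mem_edgeSet]
    constructor
    · rintro ⟨x, rfl, hx⟩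
      by_cases h : ∃ y, s(x, y) ∈ m
      · obtain ⟨y, hy⟩ := h
        change s(x, g x) ∈ m
        rw [g1 hy]; exact hy
      · exact absurd (g2 h) hx
    · intro hp
      induction p with
      | _ x y =>
      refine ⟨x, ?_, ?_⟩
      · change s(x, y) = s(x, g x)
        rw [g1 hp]
      · change g x ≠ x
        exact fun h => hfix x h ⟨y, hp⟩

noncomputable def invs (α : Type) [Fintype α] : Finset (Equiv.Perm α) :=
  Finset.univ.filter IsInv

theorem mem_invs {α : Type} [Fintype α] (σ : Equiv.Perm α) : σ ∈ invs α ↔ IsInv σ := by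
  simp [invs]

theorem configExpect_eq (V : Type) [Fintype V] [DecidableEq V] (d : V → ℕ)
    (f : Multigraph → ℝ) : configExpect V d f =
      (∑ σ ∈ invs (HalfEdge V d), f (matchingGraph V d (edgeSet σ)))
        / ((invs (HalfEdge V d)).card : ℝ) := by
  have himg : maximalMatchings V d = (invs (HalfEdge V d)).image edgeSet := by
    ext m
    simp only [maximalMatchings, Finset.mem_filter, Finset.mem_univ, true_and, Finset.mem_image,
      mem_invs]
    constructor
    · exact edgeSet_surj
    · rintro ⟨σ, h, rfl⟩
      exact edgeSet_maximal h
  have hinj : Set.InjOn edgeSet (invs (HalfEdge V d) : Set (Equiv.Perm (HalfEdge V d))) := by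
    intro σ hσ τ hτ h
    exact edgeSet_inj ((mem_invs _).1 hσ) ((mem_invs _).1 hτ) h
  unfold configExpect
  rw [himg, Finset.sum_image hinj, Finset.card_image_of_injOn hinj]

theorem cycleType_of_isInv {α : Type} [Fintype α] {σ : Equiv.Perm α} (hσ : IsInv σ) :
    σ.cycleType = Multiset.replicate (Fintype.card α / 2) 2 := by
  have hsq : σ ^ 2 = 1 := by
    ext x; simp [pow_two, hσ.1]
  have h2 : ∀ a ∈ σ.cycleType, a = 2 := by
    intro a ha
    have h1 := Equiv.Perm.dvd_of_mem_cycleType ha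
    have h3 : orderOf σ ∣ 2 := orderOf_dvd_of_pow_eq_one hsq
    have h4 := Nat.le_of_dvd (by norm_num) (h1.trans h3)
    have h5 := Equiv.Perm.two_le_of_mem_cycleType ha
    omega
  have hrep := Multiset.eq_replicate_card.2 h2
  have hsum := Equiv.Perm.sum_cycleType σ
  have hc : σ.support.card + (σ.supportᶜ).card = Fintype.card α := Finset.card_add_card_compl _
  have hc1 : (σ.supportᶜ).card ≤ 1 := by
    rw [Finset.card_le_one]
    intro a ha b hb
    simp at ha hb
    exact hσ.2 _ _ ha hb
  rw [hrep] at hsum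
  simp at hsum
  rw [hrep]
  congr 1
  omega

theorem isInv_conj {α : Type} [Fintype α] {σ τ : Equiv.Perm α} (hσ : IsInv σ) (hτ : IsInv τ) :
    ∃ c : Equiv.Perm α, c * σ * c⁻¹ = τ := by
  rw [← isConj_iff, Equiv.Perm.isConj_iff_cycleType_eq, cycleType_of_isInv hσ,
    cycleType_of_isInv hτ]

theorem IsInv.conj {α : Type} {σ : Equiv.Perm α} (hσ : IsInv σ) (c : Equiv.Perm α) :
    IsInv (c * σ * c⁻¹) := by
  refine ⟨fun x => by simp [hσ.1], fun x y hx hy => ?_⟩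
  have hx' : σ (c⁻¹ x) = c⁻¹ x := by
    apply c.injective; simpa using hx
  have hy' : σ (c⁻¹ y) = c⁻¹ y := by
    apply c.injective; simpa using hy
  exact c⁻¹.injective (hσ.2 _ _ hx' hy')

theorem invs_nonempty (α : Type) [Fintype α] : (invs α).Nonempty := by
  obtain ⟨σ, hσ⟩ := (Equiv.Perm.exists_with_cycleType_iff α
    (m := Multiset.replicate (Fintype.card α / 2) 2)).2 (by
      constructor
      · simp; omega
      · intro a ha; rw [Multiset.eq_of_mem_replicate ha])
  refine ⟨σ, (mem_invs _).2 ⟨?_, ?_⟩⟩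
  · have h1 : orderOf σ ∣ 2 := by
      rw [← Equiv.Perm.lcm_cycleType, hσ, Multiset.lcm_dvd]
      intro a ha; rw [Multiset.eq_of_mem_replicate ha]
    have h2 := orderOf_dvd_iff_pow_eq_one.1 h1
    intro x
    have := congrArg (fun τ : Equiv.Perm α => τ x) h2
    simpa [pow_two] using this
  · have hsum := Equiv.Perm.sum_cycleType σ
    have hc : σ.support.card + (σ.supportᶜ).card = Fintype.card α := Finset.card_add_card_compl _
    rw [hσ] at hsum
    simp at hsum
    have hc1 : (σ.supportᶜ).card ≤ 1 := by omega
    rw [Finset.card_le_one] at hc1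
    intro x y hx hy
    exact hc1 x (by simpa using hx) y (by simpa using hy)

/-! ### Coupling of matchings when one half-edge is added -/

theorem avg_coupling {A B : Type} (S : Finset A) (T : Finset B) (R : A → B → Prop)
    (F : A → ℝ) (F' : B → ℝ) (N : ℕ) (C : ℝ) (hT : T.Nonempty)
    (hN : ∀ a ∈ S, (T.filter fun b => R a b).card = N)
    (hu : ∀ b ∈ T, ∃ a ∈ S, R a b ∧ ∀ a' ∈ S, R a' b → a' = a)
    (hC : ∀ a ∈ S, ∀ b ∈ T, R a b → |F a - F' b| ≤ C) :
    |(∑ a ∈ S, F a) / (S.card : ℝ) - (∑ b ∈ T, F' b) / (T.card : ℝ)| ≤ C := by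
  obtain ⟨b₀, hb₀⟩ := hT
  obtain ⟨a₀, -, -⟩ := hu b₀ hb₀
  have : ∃ φ : B → A, ∀ b ∈ T, φ b ∈ S ∧ R (φ b) b ∧ ∀ a' ∈ S, R a' b → a' = φ b := by
    refine ⟨fun b => if h : b ∈ T then (hu b h).choose else a₀, fun b hb => ?_⟩
    simp only [dif_pos hb]
    exact (hu b hb).choose_spec
  obtain ⟨φ, hφ⟩ := this
  have hfil : ∀ a ∈ S, (T.filter fun b => φ b = a) = T.filter fun b => R a b := by
    intro a ha
    apply Finset.filter_congr
    intro b hb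
    constructor
    · rintro rfl; exact (hφ b hb).2.1
    · intro h; exact ((hφ b hb).2.2 a ha h).symm
  have hsum : ∑ b ∈ T, F (φ b) = N * ∑ a ∈ S, F a := by
    rw [← Finset.sum_fiberwise_of_maps_to (s := T) (t := S) (g := φ) (fun b hb => (hφ b hb).1),
      Finset.mul_sum]
    refine Finset.sum_congr rfl fun a ha => ?_
    rw [Finset.sum_congr rfl (g := fun _ => F a), Finset.sum_const, hfil a ha, hN a ha, nsmul_eq_mul]
    intro b hb
    rw [(Finset.mem_filter.1 hb).2]
  have hcard : T.card = N * S.card := by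
    rw [Finset.card_eq_sum_card_fiberwise (f := φ) (t := S) (fun b hb => (hφ b hb).1),
      Finset.sum_congr rfl (g := fun _ => N), Finset.sum_const, smul_eq_mul, mul_comm]
    intro a ha
    rw [hfil a ha, hN a ha]
  have hTpos : 0 < T.card := Finset.card_pos.2 ⟨b₀, hb₀⟩
  have hNpos : 0 < N := by
    rcases Nat.eq_zero_or_pos N with h | h
    · simp [h] at hcard; simp [hcard] at hb₀
    · exact h
  have hSpos : 0 < S.card := by
    rcases Nat.eq_zero_or_pos S.card with h | h
    · rw [h] at hcard; omega
    · exact h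
  have hT' : (0 : ℝ) < T.card := by exact_mod_cast hTpos
  have hN' : (0 : ℝ) < N := by exact_mod_cast hNpos
  have hS' : (0 : ℝ) < S.card := by exact_mod_cast hSpos
  have e1 : (∑ a ∈ S, F a) / (S.card : ℝ) = (∑ b ∈ T, F (φ b)) / (T.card : ℝ) := by
    rw [hsum, hcard]; push_cast
    field_simp
  rw [e1, ← sub_div, ← Finset.sum_sub_distrib, abs_div, abs_of_pos hT', div_le_iff₀ hT']
  calc |∑ b ∈ T, (F (φ b) - F' b)| ≤ ∑ b ∈ T, |F (φ b) - F' b| := Finset.abs_sum_le_sum_abs _ _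
    _ ≤ ∑ b ∈ T, C := Finset.sum_le_sum fun b hb => hC _ (hφ b hb).1 _ hb (hφ b hb).2.1
    _ = C * T.card := by rw [Finset.sum_const, nsmul_eq_mul, mul_comm]

def MRel {α β : Type} (ι : α ↪ β) (σ : Equiv.Perm α) (σ' : Equiv.Perm β) : Prop :=
  ∀ x y, σ' (ι x) = ι y → x ≠ y → σ x = y

def Bad {α β : Type} (ι : α ↪ β) (b : β) (σ' : Equiv.Perm β) (x : α) : Prop :=
  σ' (ι x) = b ∨ σ' (ι x) = ι x

theorem bad_three {α β : Type} {ι : α ↪ β} {b : β} {σ' : Equiv.Perm β} (hσ' : IsInv σ')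
    {x y z : α} (hx : Bad ι b σ' x) (hy : Bad ι b σ' y) (hz : Bad ι b σ' z) :
    x = y ∨ x = z ∨ y = z := by
  have h1 : ∀ {p q : α}, σ' (ι p) = b → σ' (ι q) = b → p = q := fun h h' =>
    ι.injective (σ'.injective (h.trans h'.symm))
  have h2 : ∀ {p q : α}, σ' (ι p) = ι p → σ' (ι q) = ι q → p = q := fun h h' =>
    ι.injective (hσ'.2 _ _ h h')
  rcases hx with hx | hx <;> rcases hy with hy | hy <;> rcases hz with hz | hz
  · exact Or.inl (h1 hx hy)
  · exact Or.inl (h1 hx hy)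
  · exact Or.inr (Or.inl (h1 hx hz))
  · exact Or.inr (Or.inr (h2 hy hz))
  · exact Or.inr (Or.inr (h1 hy hz))
  · exact Or.inr (Or.inl (h2 hx hz))
  · exact Or.inl (h2 hx hy)
  · exact Or.inl (h2 hx hy)

theorem not_bad {α β : Type} {ι : α ↪ β} {b : β} (hι : ∀ z, z ≠ b → ∃ x, ι x = z)
    {σ' : Equiv.Perm β} {x : α} (hx : ¬ Bad ι b σ' x) : ∃ y, σ' (ι x) = ι y ∧ x ≠ y := by
  unfold Bad at hx
  push Not at hx
  obtain ⟨y, hy⟩ := hι _ hx.1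
  refine ⟨y, hy.symm, ?_⟩
  rintro rfl
  exact hx.2 hy.symm

theorem rel_bad {α β : Type} {ι : α ↪ β} {b : β} (hb : ∀ x, ι x ≠ b)
    (hι : ∀ z, z ≠ b → ∃ x, ι x = z)
    {σ' : Equiv.Perm β} (hσ' : IsInv σ') {σ : Equiv.Perm α} (hσ : IsInv σ) (hR : MRel ι σ σ')
    {x : α} (hx : Bad ι b σ' x) : Bad ι b σ' (σ x) := by
  by_contra hcon
  obtain ⟨y, hy, hne⟩ := not_bad hι hcon
  have h1 := hR _ _ hy hne
  rw [hσ.1] at h1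
  subst h1
  have h2 : σ' (ι x) = ι (σ x) := by rw [← hy, hσ'.1]
  rcases hx with hx | hx
  · exact hb _ (h2.symm.trans hx)
  · exact hne (ι.injective (h2.symm.trans hx))

theorem rel_unique {α β : Type} {ι : α ↪ β} {b : β} (hb : ∀ x, ι x ≠ b)
    (hι : ∀ z, z ≠ b → ∃ x, ι x = z)
    {σ' : Equiv.Perm β} (hσ' : IsInv σ') {σ τ : Equiv.Perm α} (hσ : IsInv σ) (hR : MRel ι σ σ')
    (hτ : IsInv τ) (hR' : MRel ι τ σ') : σ = τ := by
  have key : ∀ {σ τ : Equiv.Perm α}, IsInv σ → MRel ι σ σ' → IsInv τ → MRel ι τ σ' →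
      ∀ x, Bad ι b σ' x → σ x = x → τ x = x := by
    intro σ τ hσ hR hτ hR' x hx hfix
    by_contra hne
    have h1 := rel_bad hb hι hσ' hτ hR' hx
    have h2 := rel_bad hb hι hσ' hσ hR h1
    rcases bad_three hσ' hx h1 h2 with h | h | h
    · exact hne h.symm
    · have : σ x = σ (σ (τ x)) := congrArg σ h
      rw [hσ.1, hfix] at this
      exact hne this.symm
    · exact hne (hσ.2 _ _ h.symm hfix)
  ext x
  by_cases hx : Bad ι b σ' x
  · have h1 := rel_bad hb hι hσ' hσ hR hx
    have h2 := rel_bad hb hι hσ' hτ hR' hx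
    rcases bad_three hσ' hx h1 h2 with h | h | h
    · rw [key hσ hR hτ hR' x hx h.symm, h.symm]
    · rw [key hτ hR' hσ hR x hx h.symm, h.symm]
    · exact h
  · obtain ⟨y, hy, hne⟩ := not_bad hι hx
    rw [hR _ _ hy hne, hR' _ _ hy hne]

theorem rel_exists {α β : Type} {ι : α ↪ β} {b : β} (hb : ∀ x, ι x ≠ b)
    (hι : ∀ z, z ≠ b → ∃ x, ι x = z)
    {σ' : Equiv.Perm β} (hσ' : IsInv σ') : ∃ σ : Equiv.Perm α, IsInv σ ∧ MRel ι σ σ' := by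
  let g : α → α := fun x => if h : ∃ y, σ' (ι x) = ι y ∧ x ≠ y then h.choose else x
  have g1 : ∀ {x y}, σ' (ι x) = ι y → x ≠ y → g x = y := by
    intro x y h hne
    have hex : ∃ y, σ' (ι x) = ι y ∧ x ≠ y := ⟨y, h, hne⟩
    have : g x = hex.choose := dif_pos hex
    rw [this]
    exact ι.injective (hex.choose_spec.1.symm.trans h)
  have g2 : ∀ {x}, Bad ι b σ' x → g x = x := by
    intro x hx
    refine dif_neg ?_
    rintro ⟨y, hy, hne⟩
    rcases hx with hx | hx
    · exact hb _ (hy.symm.trans hx)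
    · exact hne (ι.injective (hx.symm.trans hy))
  have ginv : Function.Involutive g := by
    intro x
    by_cases hx : Bad ι b σ' x
    · rw [g2 hx, g2 hx]
    · obtain ⟨y, hy, hne⟩ := not_bad hι hx
      rw [g1 hy hne]
      exact g1 (by rw [← hy, hσ'.1]) hne.symm
  have gfix : ∀ x, g x = x → Bad ι b σ' x := by
    intro x hx
    by_contra hcon
    obtain ⟨y, hy, hne⟩ := not_bad hι hcon
    exact hne (hx.symm.trans (g1 hy hne))
  by_cases h2 : ∃ v w, v ≠ w ∧ Bad ι b σ' v ∧ Bad ι b σ' w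
  · obtain ⟨v, w, hvw, hv, hw⟩ := h2
    let k : α → α := fun x => if x = v then w else if x = w then v else g x
    have kv : k v = w := by simp [k]
    have kw : k w = v := by simp [k, hvw.symm]
    have ko : ∀ {x}, x ≠ v → x ≠ w → k x = g x := by
      intro x h1 h2; simp [k, h1, h2]
    have kinv : Function.Involutive k := by
      intro x
      by_cases hxv : x = v
      · rw [hxv, kv, kw]
      by_cases hxw : x = w
      · rw [hxw, kw, kv]
      rw [ko hxv hxw, ko, ginv]
      · intro h; apply hxv; rw [← ginv x, h, g2 hv]
      · intro h; apply hxw; rw [← ginv x, h, g2 hw]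
    have kfix : ∀ x, k x ≠ x := by
      intro x hx
      by_cases hxv : x = v
      · rw [hxv, kv] at hx; exact hvw hx.symm
      by_cases hxw : x = w
      · rw [hxw, kw] at hx; exact hvw hx
      rw [ko hxv hxw] at hx
      rcases bad_three hσ' hv hw (gfix x hx) with h | h | h
      · exact hvw h
      · exact hxv h.symm
      · exact hxw h.symm
    refine ⟨kinv.toPerm, ⟨kinv, fun x y hx _ => absurd hx (kfix x)⟩, ?_⟩
    intro x y hxy hne
    change k x = y
    have hg := g1 hxy hne
    rw [ko, hg]
    · rintro rfl; rw [g2 hv] at hg; exact hne hg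
    · rintro rfl; rw [g2 hw] at hg; exact hne hg
  · refine ⟨ginv.toPerm, ⟨ginv, ?_⟩, fun x y => g1⟩
    intro x y hx hy
    by_contra hne
    exact h2 ⟨x, y, hne, gfix x hx, gfix y hy⟩

theorem rel_conj {α β : Type} {ι : α ↪ β} {σ : Equiv.Perm α} {σ' : Equiv.Perm β}
    (hR : MRel ι σ σ') (c : Equiv.Perm α) (c' : Equiv.Perm β) (hc : ∀ x, c' (ι x) = ι (c x)) :
    MRel ι (c * σ * c⁻¹) (c' * σ' * c'⁻¹) := by
  have hc' : ∀ x, c'⁻¹ (ι x) = ι (c⁻¹ x) := by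
    intro x
    apply c'.injective
    rw [hc]; simp
  intro x y hxy hne
  have h1 : σ' (ι (c⁻¹ x)) = ι (c⁻¹ y) := by
    rw [← hc', ← hc', ← hxy]; simp
  have h2 := hR _ _ h1 (fun h => hne (c⁻¹.injective h))
  change c (σ (c⁻¹ x)) = y
  rw [h2]; simp

theorem rel_card {α β : Type} [Fintype α] [Fintype β] (ι : α ↪ β)
    {σ τ : Equiv.Perm α} (hσ : IsInv σ) (hτ : IsInv τ) :
    ((invs β).filter fun σ' => MRel ι σ σ').card = ((invs β).filter fun σ' => MRel ι τ σ').card := by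
  obtain ⟨c, rfl⟩ := isInv_conj hσ hτ
  let c' := c.viaEmbedding ι
  have hc : ∀ x, c' (ι x) = ι (c x) := fun x => Equiv.Perm.viaEmbedding_apply c ι x
  have hc' : ∀ x, c'⁻¹ (ι x) = ι (c⁻¹ x) := by
    intro x
    apply c'.injective
    rw [hc]; simp
  refine Finset.card_bij' (fun σ' _ => c' * σ' * c'⁻¹) (fun σ' _ => c'⁻¹ * σ' * c') ?_ ?_ ?_ ?_
  · intro σ' h
    simp only [Finset.mem_filter, mem_invs] at h ⊢
    exact ⟨h.1.conj c', rel_conj h.2 c c' hc⟩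
  · intro σ' h
    simp only [Finset.mem_filter, mem_invs] at h ⊢
    refine ⟨by simpa using h.1.conj c'⁻¹, ?_⟩
    have := rel_conj h.2 c⁻¹ c'⁻¹ hc'
    simpa [mul_assoc] using this
  · intro σ' _; simp [mul_assoc]
  · intro σ' _; simp [mul_assoc]

theorem lip_multiset {f : Multigraph → ℝ} {κ : ℝ} (hlip : GraphParam.Lipschitz f κ)
    (V : Type) [Fintype V] (s t : Multiset (Sym2 V)) :
    |f ⟨V, t + s⟩ - f ⟨V, s⟩| ≤ κ * Multiset.card t := by
  induction t using Multiset.induction with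
  | empty => simp
  | cons p t ih =>
    induction p with
    | _ i j =>
    have h := hlip ⟨V, t + s⟩ i j
    have e : (Multigraph.addEdge ⟨V, t + s⟩ i j) = ⟨V, s(i, j) ::ₘ t + s⟩ := by
      simp [Multigraph.addEdge]
    rw [e] at h
    have := abs_add_le (f ⟨V, s(i, j) ::ₘ t + s⟩ - f ⟨V, t + s⟩) (f ⟨V, t + s⟩ - f ⟨V, s⟩)
    rw [sub_add_sub_cancel] at this
    rw [Multiset.card_cons]
    push_cast
    linarith

theorem lip_finset {f : Multigraph → ℝ} {κ : ℝ} (hlip : GraphParam.Lipschitz f κ)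
    (V : Type) [Fintype V] {β : Type} (π : β → V) (P Q : Finset (Sym2 β)) (hκ : 0 ≤ κ)
    (h1 : (P \ Q).card ≤ 1) (h2 : (Q \ P).card ≤ 1) :
    |f ⟨V, P.val.map (Sym2.map π)⟩ - f ⟨V, Q.val.map (Sym2.map π)⟩| ≤ 2 * κ := by
  have hdec : ∀ P Q : Finset (Sym2 β), P.val = (P \ Q).val + (P ∩ Q).val := by
    intro P Q
    rw [← Finset.disjUnion_val _ _ (Finset.disjoint_sdiff_inter P Q),
      Finset.disjUnion_eq_union, Finset.sdiff_union_inter]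
  have a1 := lip_multiset hlip V ((P ∩ Q).val.map (Sym2.map π)) ((P \ Q).val.map (Sym2.map π))
  have a2 := lip_multiset hlip V ((Q ∩ P).val.map (Sym2.map π)) ((Q \ P).val.map (Sym2.map π))
  rw [← Multiset.map_add, ← hdec, Multiset.card_map, Finset.card_val] at a1 a2
  rw [Finset.inter_comm Q P] at a2
  have b1 : κ * ((P \ Q).card : ℝ) ≤ κ * 1 :=
    mul_le_mul_of_nonneg_left (by exact_mod_cast h1) hκ
  have b2 : κ * ((Q \ P).card : ℝ) ≤ κ * 1 :=
    mul_le_mul_of_nonneg_left (by exact_mod_cast h2) hκ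
  rw [abs_le] at *
  constructor <;> linarith [a1.1, a1.2, a2.1, a2.2]

theorem rel_edges {α β : Type} [Fintype α] [Fintype β] {ι : α ↪ β} {b : β} (hb : ∀ x, ι x ≠ b)
    (hι : ∀ z, z ≠ b → ∃ x, ι x = z)
    {σ' : Equiv.Perm β} (hσ' : IsInv σ') {σ : Equiv.Perm α} (hσ : IsInv σ) (hR : MRel ι σ σ') :
    (((edgeSet σ).map ι.sym2Map) \ edgeSet σ').card ≤ 1 ∧
    (edgeSet σ' \ ((edgeSet σ).map ι.sym2Map)).card ≤ 1 := by
  constructor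
  · have key : ∀ p ∈ ((edgeSet σ).map ι.sym2Map) \ edgeSet σ', ∃ x, Bad ι b σ' x ∧
        Bad ι b σ' (σ x) ∧ σ x ≠ x ∧ p = s(ι x, ι (σ x)) := by
      intro p hp
      obtain ⟨hp1, hp2⟩ := Finset.mem_sdiff.1 hp
      obtain ⟨q, hq, rfl⟩ := Finset.mem_map.1 hp1
      obtain ⟨x, rfl, hx⟩ := (mem_edgeSet _ _).1 hq
      have hbad : Bad ι b σ' x := by
        by_contra hcon
        obtain ⟨y, hy, hne⟩ := not_bad hι hcon
        apply hp2
        refine (mem_edgeSet _ _).2 ⟨ι x, ?_, ?_⟩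
        · rw [hy, ← hR _ _ hy hne]; rfl
        · rw [hy]; exact fun h => hne (ι.injective h).symm
      exact ⟨x, hbad, rel_bad hb hι hσ' hσ hR hbad, hx, rfl⟩
    rw [Finset.card_le_one]
    intro p hp q hq
    obtain ⟨x, h1, h2, h3, rfl⟩ := key p hp
    obtain ⟨y, h4, h5, h6, rfl⟩ := key q hq
    rcases bad_three hσ' h1 h2 h4 with h | h | h
    · exact absurd h.symm h3
    · rw [h]
    · rw [← h, hσ.1]; exact Sym2.eq_swap
  · refine le_trans (Finset.card_le_card (t := {s(b, σ' b)}) ?_) (by simp)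
    intro q hq
    obtain ⟨hq1, hq2⟩ := Finset.mem_sdiff.1 hq
    rw [Finset.mem_singleton]
    by_cases hbq : b ∈ q
    · exact (edgeSet_eq_of_mem hσ' hq1 hbq).1
    · exfalso
      obtain ⟨z, rfl, hz⟩ := (mem_edgeSet _ _).1 hq1
      rw [Sym2.mem_iff] at hbq
      push Not at hbq
      obtain ⟨x, hx⟩ := hι z (fun h => hbq.1 h.symm)
      obtain ⟨y, hy⟩ := hι (σ' z) (fun h => hbq.2 h.symm)
      have hne : x ≠ y := by rintro rfl; exact hz (hy.symm.trans hx)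
      have hxy : σ' (ι x) = ι y := by rw [hx, hy]
      have hs := hR _ _ hxy hne
      apply hq2
      refine Finset.mem_map.2 ⟨s(x, σ x), (mem_edgeSet _ _).2 ⟨x, rfl, ?_⟩, ?_⟩
      · rw [hs]; exact hne.symm
      · rw [hs, ← hx, hxy]; rfl

theorem lip_nonneg {f : Multigraph → ℝ} {κ : ℝ} (hlip : GraphParam.Lipschitz f κ) : 0 ≤ κ :=
  (abs_nonneg _).trans (hlip ⟨Unit, 0⟩ () ())

theorem configExpect_step {f : Multigraph → ℝ} {κ : ℝ} (hlip : GraphParam.Lipschitz f κ)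
    (V : Type) [Fintype V] [DecidableEq V] (d d' : V → ℕ) (i : V) (hi : d' i = d i + 1)
    (hj : ∀ j, j ≠ i → d' j = d j) :
    |configExpect V d f - configExpect V d' f| ≤ 2 * κ := by
  have hle : ∀ j, d j ≤ d' j := by
    intro j
    by_cases h : j = i
    · subst h; omega
    · rw [hj j h]
  let ι : HalfEdge V d ↪ HalfEdge V d' :=
    ⟨fun x => ⟨x.1, Fin.castLE (hle x.1) x.2⟩, by
      rintro ⟨j, s⟩ ⟨k, t⟩ h
      obtain ⟨h1, h2⟩ := Sigma.mk.inj_iff.1 h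
      change j = k at h1
      subst h1
      simpa using h2⟩
  let b : HalfEdge V d' := ⟨i, ⟨d i, by omega⟩⟩
  have hb : ∀ x, ι x ≠ b := by
    rintro ⟨j, s⟩ h
    obtain ⟨h1, h2⟩ := Sigma.mk.inj_iff.1 h
    change j = i at h1
    subst h1
    have h3 := congrArg Fin.val (eq_of_heq h2)
    have := s.2
    simp at h3
    omega
  have hι : ∀ z, z ≠ b → ∃ x, ι x = z := by
    rintro ⟨j, s⟩ hz
    have hs : (s : ℕ) < d j := by
      by_cases h : j = i
      · subst h
        have := s.2
        rcases Nat.lt_or_ge (s : ℕ) (d j) with h' | h'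
        · exact h'
        · exfalso; apply hz
          have : s = ⟨d j, by omega⟩ := by ext; simp; omega
          rw [this]
      · have := s.2
        exact lt_of_lt_of_eq this (hj j h)
    exact ⟨⟨j, ⟨s, hs⟩⟩, rfl⟩
  have hκ := lip_nonneg hlip
  rw [configExpect_eq, configExpect_eq]
  obtain ⟨σ₀, hσ₀⟩ := invs_nonempty (HalfEdge V d)
  refine avg_coupling _ _ (MRel ι) _ _
    ((invs (HalfEdge V d')).filter fun σ' => MRel ι σ₀ σ').card _ (invs_nonempty _) ?_ ?_ ?_
  · intro σ hσ
    exact rel_card ι ((mem_invs _).1 hσ) ((mem_invs _).1 hσ₀)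
  · intro σ' hσ'
    have hσ' := (mem_invs _).1 hσ'
    obtain ⟨σ, h1, h2⟩ := rel_exists hb hι hσ'
    exact ⟨σ, (mem_invs _).2 h1, h2, fun τ hτ hR =>
      rel_unique hb hι hσ' ((mem_invs _).1 hτ) hR h1 h2⟩
  · intro σ hσ σ' hσ' hR
    obtain ⟨e1, e2⟩ := rel_edges hb hι ((mem_invs _).1 hσ') ((mem_invs _).1 hσ) hR
    have := lip_finset hlip V (Sigma.fst : HalfEdge V d' → V) _ _ hκ e1 e2
    have e3 : ((edgeSet σ).map ι.sym2Map).val.map (Sym2.map (Sigma.fst : HalfEdge V d' → V)) =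
        (edgeSet σ).val.map (Sym2.map (Sigma.fst : HalfEdge V d → V)) := by
      rw [Finset.map_val, Multiset.map_map]
      refine Multiset.map_congr rfl fun p _ => ?_
      induction p with
      | _ x y => rfl
    rw [e3] at this
    exact this

/-! ### Sums over i.i.d. degrees -/

def CoordLip {n : ℕ} (c : ℝ) (F : (Fin n → ℕ) → ℝ) : Prop :=
  ∀ D D' i, D' i = D i + 1 → (∀ j, j ≠ i → D' j = D j) → |F D' - F D| ≤ c

structure IsProb (μ : ℕ → ℝ) : Prop where
  nonneg : ∀ k, 0 ≤ μ k
  sum : HasSum μ 1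
  mean : Summable fun k : ℕ => (k : ℝ) * μ k

theorem CoordLip.abs {n : ℕ} {c : ℝ} {F : (Fin n → ℕ) → ℝ} (h : CoordLip c F) :
    CoordLip c fun D => |F D| := fun D D' i h1 h2 =>
  (abs_abs_sub_abs_le _ _).trans (h D D' i h1 h2)

theorem CoordLip.cons {n : ℕ} {c : ℝ} {F : (Fin (n + 1) → ℕ) → ℝ} (h : CoordLip c F) (k : ℕ) :
    CoordLip c fun D : Fin n → ℕ => F (Fin.cons k D) := by
  intro D D' i h1 h2
  refine h _ _ i.succ (by simpa using h1) ?_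
  intro j hj
  refine Fin.cases (fun _ => rfl) (fun j hj => ?_) j hj
  simpa using h2 j (fun h => hj (by rw [h]))

theorem CoordLip.cons_step {n : ℕ} {c : ℝ} {F : (Fin (n + 1) → ℕ) → ℝ} (h : CoordLip c F) (k : ℕ)
    (D : Fin n → ℕ) : |F (Fin.cons (k + 1) D) - F (Fin.cons k D)| ≤ c := by
  refine h _ _ 0 rfl ?_
  intro j hj
  refine Fin.cases (fun h => absurd rfl h) (fun j _ => rfl) j hj

theorem lip_growth {c : ℝ} {g : ℕ → ℝ} (hg : ∀ k, |g (k + 1) - g k| ≤ c) (k : ℕ) :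
    |g k| ≤ |g 0| + c * k := by
  induction k with
  | zero => simp
  | succ k ih =>
    have h1 := abs_add_le (g (k + 1) - g k) (g k)
    rw [sub_add_cancel] at h1
    push_cast
    linarith [hg k]

theorem summable_lip {μ : ℕ → ℝ} (hμ : IsProb μ) {c : ℝ} {g : ℕ → ℝ}
    (hg : ∀ k, |g (k + 1) - g k| ≤ c) : Summable fun k => μ k * g k := by
  refine Summable.of_norm_bounded (g := fun k => |g 0| * μ k + c * (k * μ k))
    ((hμ.sum.summable.mul_left _).add (hμ.mean.mul_left _)) fun k => ?_
  rw [Real.norm_eq_abs, abs_mul, abs_of_nonneg (hμ.nonneg k)]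
  nlinarith [lip_growth hg k, hμ.nonneg k, mul_le_mul_of_nonneg_left (lip_growth hg k) (hμ.nonneg k)]

noncomputable def iidSum (μ : ℕ → ℝ) (n : ℕ) (F : (Fin n → ℕ) → ℝ) : ℝ :=
  ∑' D : Fin n → ℕ, (∏ i, μ (D i)) * F D

theorem wt_nonneg {μ : ℕ → ℝ} (hμ : IsProb μ) {n : ℕ} (D : Fin n → ℕ) : 0 ≤ ∏ i, μ (D i) :=
  Finset.prod_nonneg fun i _ => hμ.nonneg _

/-- Basic facts on `iidSum`, proved by a common induction on `n`. -/
theorem iid_basic {μ : ℕ → ℝ} (hμ : IsProb μ) {c : ℝ} (hc : 0 ≤ c) (n : ℕ) :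
    (∀ F : (Fin n → ℕ) → ℝ, CoordLip c F → Summable fun D => (∏ i, μ (D i)) * F D) ∧
    HasSum (fun D : Fin n → ℕ => ∏ i, μ (D i)) 1 ∧
    (∀ F G : (Fin n → ℕ) → ℝ, CoordLip c F → CoordLip c G → ∀ C, (∀ D, |F D - G D| ≤ C) →
      |iidSum μ n F - iidSum μ n G| ≤ C) := by
  have third : ∀ n,
      (∀ F : (Fin n → ℕ) → ℝ, CoordLip c F → Summable fun D => (∏ i, μ (D i)) * F D) →
      HasSum (fun D : Fin n → ℕ => ∏ i, μ (D i)) 1 →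
      (∀ F G : (Fin n → ℕ) → ℝ, CoordLip c F → CoordLip c G → ∀ C, (∀ D, |F D - G D| ≤ C) →
      |iidSum μ n F - iidSum μ n G| ≤ C) := by
    intro n hs h1 F G hF hG C hC
    unfold iidSum
    rw [← (hs F hF).tsum_sub (hs G hG)]
    have hsC : HasSum (fun D : Fin n → ℕ => (∏ i, μ (D i)) * C) C := by
      simpa using h1.mul_right C
    rw [← Real.norm_eq_abs]
    refine tsum_of_norm_bounded hsC fun D => ?_
    rw [← mul_sub, Real.norm_eq_abs, abs_mul, abs_of_nonneg (wt_nonneg hμ D)]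
    exact mul_le_mul_of_nonneg_left (hC D) (wt_nonneg hμ D)
  induction n with
  | zero =>
    have hs : ∀ F : (Fin 0 → ℕ) → ℝ, CoordLip c F → Summable fun D => (∏ i, μ (D i)) * F D :=
      fun F _ => (hasSum_fintype _).summable
    have h1 : HasSum (fun D : Fin 0 → ℕ => ∏ i, μ (D i)) 1 := by
      have := hasSum_fintype (fun D : Fin 0 → ℕ => ∏ i, μ (D i))
      simpa using this
    exact ⟨hs, h1, third 0 hs h1⟩
  | succ n ih =>
    obtain ⟨ih1, ih2, ih3⟩ := ih
    have hs : ∀ F : (Fin (n + 1) → ℕ) → ℝ, CoordLip c F →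
        Summable fun D => (∏ i, μ (D i)) * F D := by
      intro F hF
      rw [← (Fin.consEquiv fun _ : Fin (n + 1) => ℕ).summable_iff]
      refine Summable.of_norm ?_
      rw [summable_prod_of_nonneg (fun _ => norm_nonneg _)]
      have e : ∀ (k : ℕ) (D : Fin n → ℕ),
          ‖((fun D : Fin (n + 1) → ℕ => (∏ i, μ (D i)) * F D) ∘
            (Fin.consEquiv fun _ : Fin (n + 1) => ℕ)) (k, D)‖ =
          μ k * ((∏ i, μ (D i)) * |F (Fin.cons k D)|) := by
        intro k D
        have := wt_nonneg hμ D
        simp [Fin.consEquiv, Fin.prod_univ_succ, abs_mul, abs_of_nonneg (hμ.nonneg k), mul_assoc,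
          Finset.abs_prod, fun k => abs_of_nonneg (hμ.nonneg k)]
      simp only [e]
      refine ⟨fun k => (ih1 _ (hF.cons k).abs).mul_left _, ?_⟩
      simp only [tsum_mul_left]
      refine summable_lip hμ (c := c) fun k => ?_
      exact ih3 _ _ (hF.cons (k + 1)).abs (hF.cons k).abs c fun D =>
        (abs_abs_sub_abs_le _ _).trans (hF.cons_step k D)
    have h1 : HasSum (fun D : Fin (n + 1) → ℕ => ∏ i, μ (D i)) 1 := by
      have hsum1 : Summable fun D : Fin (n + 1) → ℕ => ∏ i, μ (D i) := by
        have := hs (fun _ => 1) (fun D D' i _ _ => by simpa using hc)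
        simpa using this
      have hsum2 := (Fin.consEquiv fun _ : Fin (n + 1) => ℕ).summable_iff.2 hsum1
      rw [hsum1.hasSum_iff, ← (Fin.consEquiv fun _ : Fin (n + 1) => ℕ).tsum_eq]
      refine (Summable.tsum_prod hsum2).trans ?_
      have e : ∀ (k : ℕ) (D : Fin n → ℕ),
          (∏ i, μ ((Fin.consEquiv fun _ : Fin (n + 1) => ℕ) (k, D) i)) = μ k * ∏ i, μ (D i) := by
        intro k D
        simp [Fin.consEquiv, Fin.prod_univ_succ]
      simp only [Function.comp, e, tsum_mul_left, ih2.tsum_eq, mul_one]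
      exact hμ.sum.tsum_eq
    exact ⟨hs, h1, third _ hs h1⟩

theorem iidSum_succ {μ : ℕ → ℝ} (hμ : IsProb μ) {c : ℝ} (hc : 0 ≤ c) (n : ℕ)
    {F : (Fin (n + 1) → ℕ) → ℝ} (hF : CoordLip c F) :
    iidSum μ (n + 1) F = ∑' k, μ k * iidSum μ n fun D => F (Fin.cons k D) := by
  have hs := (iid_basic hμ hc (n + 1)).1 F hF
  have hs2 := (Fin.consEquiv fun _ : Fin (n + 1) => ℕ).summable_iff.2 hs
  unfold iidSum
  rw [← (Fin.consEquiv fun _ : Fin (n + 1) => ℕ).tsum_eq]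
  refine (Summable.tsum_prod hs2).trans ?_
  refine tsum_congr fun k => ?_
  rw [← tsum_mul_left]
  refine tsum_congr fun D => ?_
  simp [Fin.consEquiv, Fin.prod_univ_succ, mul_assoc]

theorem tail_double {μ : ℕ → ℝ} (hμ : IsProb μ) {c : ℝ} (hc : 0 ≤ c) {δ : ℕ → ℝ}
    (hδ : ∀ i, |δ i| ≤ c) :
    Summable (fun i => δ i * tailSum μ (i + 1)) ∧
    ∑' k, μ k * ∑ i ∈ Finset.range k, δ i = ∑' i, δ i * tailSum μ (i + 1) := by
  let h : ℕ × ℕ → ℝ := fun p => if p.2 + 1 ≤ p.1 then μ p.1 * δ p.2 else 0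
  have hin : ∀ (k : ℕ) (φ : ℕ → ℝ), HasSum (fun i => if i + 1 ≤ k then φ i else 0)
      (∑ i ∈ Finset.range k, φ i) := by
    intro k φ
    have : HasSum (fun i => if i + 1 ≤ k then φ i else 0)
        (∑ i ∈ Finset.range k, if i + 1 ≤ k then φ i else 0) :=
      hasSum_sum_of_ne_finset_zero (fun i hi => by
        rw [Finset.mem_range] at hi
        exact if_neg (by omega))
    convert this using 1
    refine Finset.sum_congr rfl fun i hi => ?_
    rw [Finset.mem_range] at hi
    exact (if_pos (by omega)).symm
  have hnorm : ∀ k i, ‖h (k, i)‖ = if i + 1 ≤ k then μ k * |δ i| else 0 := by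
    intro k i
    by_cases hik : i + 1 ≤ k
    · simp only [h, if_pos hik, Real.norm_eq_abs, abs_mul, abs_of_nonneg (hμ.nonneg k)]
    · simp only [h, if_neg hik, norm_zero]
  have hsum : Summable h := by
    refine Summable.of_norm ?_
    rw [summable_prod_of_nonneg (fun _ => norm_nonneg _)]
    simp only [hnorm]
    refine ⟨fun k => (hin k _).summable, ?_⟩
    simp only [(hin _ _).tsum_eq, ← Finset.mul_sum]
    refine summable_lip hμ (c := c) fun k => ?_
    rw [Finset.sum_range_succ, add_sub_cancel_left, abs_abs]
    exact hδ k
  have hcol : ∀ i, ∑' k, h (k, i) = δ i * tailSum μ (i + 1) := by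
    intro i
    unfold tailSum
    rw [← tsum_mul_left]
    refine tsum_congr fun k => ?_
    simp only [h]
    split_ifs <;> ring
  constructor
  · have := hsum.prod_symm.prod
    simpa [hcol] using this
  · simp only [← hcol]
    refine Eq.trans ?_ (Summable.tsum_comm (f := fun k i => h (k, i)) hsum).symm
    refine tsum_congr fun k => ?_
    rw [Finset.mul_sum]
    exact (hin k _).tsum_eq.symm

theorem tail_summable {μ : ℕ → ℝ} (hμ : IsProb μ) : Summable fun i => tailSum μ (i + 1) := by
  simpa using (tail_double hμ (c := 1) zero_le_one (δ := fun _ => 1) (by simp)).1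

theorem wass_summable {μ μ' : ℕ → ℝ} (hμ : IsProb μ) (hμ' : IsProb μ') :
    Summable fun i => |tailSum μ (i + 1) - tailSum μ' (i + 1)| :=
  ((tail_summable hμ).sub (tail_summable hμ')).abs

theorem one_dim {μ μ' : ℕ → ℝ} (hμ : IsProb μ) (hμ' : IsProb μ') {c : ℝ} (hc : 0 ≤ c) {g : ℕ → ℝ}
    (hg : ∀ k, |g (k + 1) - g k| ≤ c) :
    |∑' k, μ k * g k - ∑' k, μ' k * g k| ≤ c * wasserstein μ μ' := by
  have key : ∀ {ν : ℕ → ℝ}, IsProb ν →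
      ∑' k, ν k * g k = g 0 + ∑' i, (g (i + 1) - g i) * tailSum ν (i + 1) := by
    intro ν hν
    rw [← (tail_double hν hc hg).2]
    have hS : Summable fun k => ν k * ∑ i ∈ Finset.range k, (g (i + 1) - g i) := by
      refine summable_lip hν (c := c) fun k => ?_
      rw [Finset.sum_range_succ, add_sub_cancel_left]
      exact hg k
    have hS0 : HasSum (fun k => ν k * g 0) (g 0) := by simpa using hν.sum.mul_right (g 0)
    conv_rhs => rw [← hS0.tsum_eq]
    rw [← hS0.summable.tsum_add hS]
    refine tsum_congr fun k => ?_
    rw [Finset.sum_range_sub]; ring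
  rw [key hμ, key hμ', add_sub_add_left_eq_sub,
    ← (tail_double hμ hc hg).1.tsum_sub (tail_double hμ' hc hg).1, ← Real.norm_eq_abs]
  refine tsum_of_norm_bounded ((wass_summable hμ hμ').hasSum.mul_left c) fun i => ?_
  rw [← mul_sub, Real.norm_eq_abs, abs_mul]
  exact mul_le_mul_of_nonneg_right (hg i) (abs_nonneg _)

theorem iid_diff {μ μ' : ℕ → ℝ} (hμ : IsProb μ) (hμ' : IsProb μ') {c : ℝ} (hc : 0 ≤ c) (n : ℕ) :
    ∀ F : (Fin n → ℕ) → ℝ, CoordLip c F →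
      |iidSum μ n F - iidSum μ' n F| ≤ n * (c * wasserstein μ μ') := by
  induction n with
  | zero =>
    intro F _
    simp [iidSum]
  | succ n ih =>
    intro F hF
    rw [iidSum_succ hμ hc n hF, iidSum_succ hμ' hc n hF]
    have l1 : ∀ k, |iidSum μ n (fun D => F (Fin.cons (k + 1) D)) -
        iidSum μ n (fun D => F (Fin.cons k D))| ≤ c := fun k =>
      (iid_basic hμ hc n).2.2 _ _ (hF.cons _) (hF.cons _) c (hF.cons_step k)
    have l2 : ∀ k, |iidSum μ' n (fun D => F (Fin.cons (k + 1) D)) -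
        iidSum μ' n (fun D => F (Fin.cons k D))| ≤ c := fun k =>
      (iid_basic hμ' hc n).2.2 _ _ (hF.cons _) (hF.cons _) c (hF.cons_step k)
    have h1 := one_dim hμ hμ' hc (g := fun k => iidSum μ' n (fun D => F (Fin.cons k D))) l2
    have h2 : |∑' k, μ k * iidSum μ n (fun D => F (Fin.cons k D)) -
        ∑' k, μ k * iidSum μ' n (fun D => F (Fin.cons k D))| ≤ n * (c * wasserstein μ μ') := by
      rw [← (summable_lip hμ (g := fun k => iidSum μ n (fun D => F (Fin.cons k D))) l1).tsum_sub
        (summable_lip hμ (g := fun k => iidSum μ' n (fun D => F (Fin.cons k D))) l2), ← Real.norm_eq_abs]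
      have hb : HasSum (fun k => μ k * (n * (c * wasserstein μ μ'))) (n * (c * wasserstein μ μ')) := by
        simpa using hμ.sum.mul_right (n * (c * wasserstein μ μ'))
      refine tsum_of_norm_bounded hb fun k => ?_
      rw [← mul_sub, Real.norm_eq_abs, abs_mul, abs_of_nonneg (hμ.nonneg k)]
      exact mul_le_mul_of_nonneg_left (ih _ (hF.cons k)) (hμ.nonneg k)
    have h3 := abs_sub_le (∑' k, μ k * iidSum μ n (fun D => F (Fin.cons k D)))
      (∑' k, μ k * iidSum μ' n (fun D => F (Fin.cons k D)))
      (∑' k, μ' k * iidSum μ' n (fun D => F (Fin.cons k D)))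
    push_cast
    linarith

theorem statement1 (f : Multigraph → ℝ) (κ : ℝ)
    (hinv : GraphParam.Invariant f) (hadd : GraphParam.Additive f)
    (hlip : GraphParam.Lipschitz f κ) (hconc : GraphParam.Concave f)
    (μ μ' : ℕ → ℝ)
    (hμ0 : ∀ k, 0 ≤ μ k) (hμ1 : HasSum μ 1) (hμmean : Summable fun k : ℕ => (k : ℝ) * μ k)
    (hμ'0 : ∀ k, 0 ≤ μ' k) (hμ'1 : HasSum μ' 1) (hμ'mean : Summable fun k : ℕ => (k : ℝ) * μ' k)
    (Ψμ Ψμ' : ℝ)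
    (hΨμ : Tendsto (fun n => iidExpect μ n f / (n : ℝ)) atTop (nhds Ψμ))
    (hΨμ' : Tendsto (fun n => iidExpect μ' n f / (n : ℝ)) atTop (nhds Ψμ')) :
    |Ψμ - Ψμ'| ≤ 2 * κ * wasserstein μ μ' := by
  have hμ : IsProb μ := ⟨hμ0, hμ1, hμmean⟩
  have hμ' : IsProb μ' := ⟨hμ'0, hμ'1, hμ'mean⟩
  have hκ := lip_nonneg hlip
  have hlim := (hΨμ.sub hΨμ').abs
  refine le_of_tendsto hlim ?_
  filter_upwards [eventually_gt_atTop 0] with n hn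
  have hn' : (0 : ℝ) < n := by exact_mod_cast hn
  have hF : CoordLip (2 * κ) fun D : Fin n → ℕ => configExpect (Fin n) D f := by
    intro D D' i h1 h2
    rw [abs_sub_comm]
    exact configExpect_step hlip (Fin n) D D' i h1 h2
  have h := iid_diff hμ hμ' (by positivity) n _ hF
  change |iidExpect μ n f - iidExpect μ' n f| ≤ _ at h
  rw [← sub_div, abs_div, abs_of_pos hn', div_le_iff₀ hn']
  linarith
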